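/- arXiv:1106.0577 — 2 statements merged into one kernel-verified Lean document; each statement's English description precedes it below -/
import Mathlib

section
/- For every irrational θ ∈ (0,1), the strictly heavy set H*_θ = {x ∈ [0,1) : Sₙ(x) > 0 for all n ≥ 1} contains exactly one point. -/
open Filter Set

/-- The function `f = χ_{[0,1/2]} - χ_{(1/2,1)}` on the circle, evaluated at `x mod 1`. -/
noncomputable def circf (x : ℝ) : ℝ := if Int.fract x ≤ 1/2 then 1 else -1

/-- Birkhoff sums `Sₙ(x) = Σ_{i=0}^{n-1} f(x + iθ)`. -/
noncomputable def birk (θ : ℝ) (n : ℕ) (x : ℝ) : ℝ :=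
  ∑ i ∈ Finset.range n, circf (x + i * θ)

/-- The heavy set `H_θ`. -/
noncomputable def heavy (θ : ℝ) : Set ℝ :=
  {x ∈ Set.Ico (0:ℝ) 1 | ∀ n : ℕ, 1 ≤ n → 0 ≤ birk θ n x}

/-- The strictly heavy set `H*_θ`. -/
noncomputable def sheavy (θ : ℝ) : Set ℝ :=
  {x ∈ Set.Ico (0:ℝ) 1 | ∀ n : ℕ, 1 ≤ n → 0 < birk θ n x}


lemma dense_nat {α : ℝ} (hα : Irrational α) {a b : ℝ} (hab : a < b) :
    ∃ n : ℕ, ∃ l : ℤ, a < n * α + l ∧ n * α + l < b := by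
  have : Fact ((0:ℝ) < 1) := ⟨one_pos⟩
  have h1 : DenseRange (· • (α : AddCircle (1:ℝ)) : ℤ → AddCircle (1:ℝ)) := by
    rw [AddCircle.denseRange_zsmul_coe_iff]; simpa using hα
  rw [denseRange_zsmul_iff_nsmul] at h1
  have ho : IsOpen (((↑) : ℝ → AddCircle (1:ℝ)) '' Set.Ioo a b) :=
    QuotientAddGroup.isOpenMap_coe _ isOpen_Ioo
  obtain ⟨n, x, hx, hxn⟩ := h1.exists_mem_open ho ((Set.nonempty_Ioo.2 hab).image _)
  have h2 : ((x - n * α : ℝ) : AddCircle (1:ℝ)) = 0 := by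
    rw [AddCircle.coe_sub, hxn]
    simp [← nsmul_eq_mul]
  obtain ⟨l, hl⟩ := (AddCircle.coe_eq_zero_iff _).1 h2
  simp at hl
  refine ⟨n, l, ?_, ?_⟩ <;> rw [hl]
  · have := hx.1; linarith
  · have := hx.2; linarith

lemma irr_lin {θ : ℝ} (hθ : Irrational θ) (a b : ℤ) (hb : 0 < b) : (b:ℝ) * θ ≠ a := by
  have := (hθ.intCast_mul (m := b) hb.ne').ne_int a
  exact this

lemma eps_exists {θ : ℝ} (hθ : Irrational θ) (K : ℕ) :
    ∃ ε : ℝ, 0 < ε ∧ ∀ q : ℤ, 0 < q → q ≤ K → ∀ p : ℤ, ε ≤ |q * θ - p| := by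
  induction K with
  | zero => exact ⟨1, one_pos, fun q h1 h2 => by push_cast at h2; omega⟩
  | succ K ih =>
    obtain ⟨ε, he, h⟩ := ih
    have hr : ((K:ℤ) + 1 : ℤ) * θ ≠ round (((K:ℤ) + 1 : ℤ) * θ) :=
      irr_lin hθ _ _ (by omega)
    refine ⟨min ε |((K:ℤ) + 1 : ℤ) * θ - round (((K:ℤ) + 1 : ℤ) * θ)|,
      lt_min he (abs_pos.2 (sub_ne_zero.2 hr)), fun q h1 h2 p => ?_⟩
    by_cases hq : q ≤ K
    · exact (min_le_left _ _).trans (h q h1 hq p)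
    · have : q = (K:ℤ) + 1 := by push_cast at h2; omega
      subst this
      exact (min_le_right _ _).trans (round_le _ _)

lemma farey {θ : ℝ} (hθ : Irrational θ) (h0 : 0 < θ) (h1 : θ < 1) (K : ℕ) :
    ∃ a b c d : ℤ, 0 < b ∧ 0 < d ∧ Odd b ∧ Odd d ∧ 0 < b * θ - a ∧ 0 < c - d * θ ∧
      c * b - a * d = 1 ∧ (K:ℤ) + 2 ≤ b + d := by
  induction K with
  | zero => exact ⟨0, 1, 1, 1, by simp [h0, h1]⟩
  | succ K ih =>
    obtain ⟨a, b, c, d, hb, hd, ob, od, hα, hγ, hdet, hK⟩ := ih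
    have hne := irr_lin hθ (a + c) (b + d) (by omega)
    push_cast at hne
    rcases lt_or_gt_of_ne hne with hlt | hgt
    · have hβ : 0 < (a + c : ℝ) - (b + d) * θ := by linarith
      set β : ℝ := (a + c : ℝ) - (b + d) * θ with hβd
      set α : ℝ := b * θ - a with hαd
      have hj0 : 0 ≤ ⌊α / β⌋ := Int.floor_nonneg.2 (by positivity)
      have hj1 := Int.floor_le (α / β)
      have hj2 := Int.lt_floor_add_one (α / β)
      set j := ⌊α / β⌋
      rw [le_div_iff₀ hβ] at hj1
      rw [div_lt_iff₀ hβ] at hj2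
      have hbj : 0 < b + j * (b + d) := by positivity
      have hx := irr_lin hθ (a + j * (a + c)) _ hbj
      refine ⟨a + j * (a + c), b + j * (b + d), a + (j + 1) * (a + c), b + (j + 1) * (b + d),
        hbj, by positivity, ?_, ?_, ?_, ?_, ?_, ?_⟩
      · exact ob.add_even ((ob.add_odd od).mul_left _)
      · exact ob.add_even ((ob.add_odd od).mul_left _)
      · have : (0:ℝ) ≤ (b + j * (b + d) : ℤ) * θ - (a + j * (a + c) : ℤ) := by
          push_cast; rw [hβd, hαd] at hj1; nlinarith
        exact lt_of_le_of_ne this (Ne.symm (sub_ne_zero.2 hx))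
      · push_cast; rw [hβd, hαd] at hj2; nlinarith
      · linear_combination hdet
      · push_cast; nlinarith
    · have hβ : 0 < (b + d) * θ - (a + c : ℝ) := by linarith
      set β : ℝ := (b + d) * θ - (a + c : ℝ) with hβd
      set α : ℝ := c - d * θ with hαd
      have hj0 : 0 ≤ ⌊α / β⌋ := Int.floor_nonneg.2 (by positivity)
      have hj1 := Int.floor_le (α / β)
      have hj2 := Int.lt_floor_add_one (α / β)
      set j := ⌊α / β⌋
      rw [le_div_iff₀ hβ] at hj1
      rw [div_lt_iff₀ hβ] at hj2
      have hbj : 0 < d + j * (b + d) := by positivity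
      have hx := irr_lin hθ (c + j * (a + c)) _ hbj
      refine ⟨c + (j + 1) * (a + c), d + (j + 1) * (b + d), c + j * (a + c), d + j * (b + d),
        by positivity, hbj, ?_, ?_, ?_, ?_, ?_, ?_⟩
      · exact od.add_even ((ob.add_odd od).mul_left _)
      · exact od.add_even ((ob.add_odd od).mul_left _)
      · push_cast; rw [hβd, hαd] at hj2; nlinarith
      · have : (0:ℝ) ≤ (c + j * (a + c) : ℤ) - (d + j * (b + d) : ℤ) * θ := by
          push_cast; rw [hβd, hαd] at hj1; nlinarith
        exact lt_of_le_of_ne this (Ne.symm (sub_ne_zero.2 hx.symm))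
      · linear_combination hdet
      · push_cast; nlinarith

lemma good_q {θ : ℝ} (hθ : Irrational θ) (h0 : 0 < θ) (h1 : θ < 1) (K : ℕ) :
    ∃ q p : ℤ, (K:ℤ) < q ∧ Odd q ∧ IsCoprime p q ∧ 2 * q * |q * θ - p| < 1 := by
  obtain ⟨ε, he, hε⟩ := eps_exists hθ K
  obtain ⟨n, hn⟩ := exists_nat_gt (1 / ε)
  obtain ⟨a, b, c, d, hb, hd, ob, od, hα, hγ, hdet, hK⟩ := farey hθ h0 h1 (K + n + 1)
  have hid : b * (c - d * θ) + d * (b * θ - a) = 1 := by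
    have : ((c * b - a * d : ℤ) : ℝ) = 1 := by rw [hdet]; simp
    push_cast at this; linarith
  have hbR : (1:ℝ) ≤ b := by exact_mod_cast hb
  have hdR : (1:ℝ) ≤ d := by exact_mod_cast hd
  have hbd : (b:ℝ) ≠ d := by
    intro h
    have h : b = d := by exact_mod_cast h
    subst h
    have : b ∣ 1 := ⟨c - a, by linarith⟩
    have := Int.le_of_dvd one_pos this
    push_cast at hK
    omega
  have hnε : 1 < n * ε := by rwa [div_lt_iff₀ he] at hn
  rcases lt_or_ge (2 * b * (b * θ - a)) 1 with h | h
  · refine ⟨b, a, ?_, ob, ⟨-d, c, by linarith⟩, by rwa [abs_of_pos hα]⟩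
    by_contra! hc
    have h2 := hε b hb hc a
    rw [abs_of_pos hα] at h2
    have h3 : (n:ℝ) ≤ d := by
      have : (n:ℤ) ≤ d := by push_cast at hK; omega
      exact_mod_cast this
    nlinarith [mul_pos (lt_of_lt_of_le one_pos hbR) hγ]
  · have h' : 2 * d * (c - d * θ) < 1 := by
      by_contra! hc
      have hpos : 0 < ((b:ℝ) - d) ^ 2 := by
        have := sub_ne_zero.2 hbd
        positivity
      have e1 : d ^ 2 * 1 ≤ d ^ 2 * (2 * b * (b * θ - a)) := by gcongr
      have e2 : b ^ 2 * 1 ≤ b ^ 2 * (2 * d * (c - d * θ)) := by gcongr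
      have e3 : d ^ 2 * (2 * b * (b * θ - a)) + b ^ 2 * (2 * d * (c - d * θ)) = 2 * b * d := by
        linear_combination (2 * b * d : ℝ) * hid
      nlinarith
    refine ⟨d, c, ?_, od, ⟨b, -a, by linarith⟩, by rwa [abs_sub_comm, abs_of_pos hγ]⟩
    by_contra! hc
    have h2 := hε d hd hc c
    rw [abs_sub_comm, abs_of_pos hγ] at h2
    have h3 : (n:ℝ) ≤ b := by
      have : (n:ℤ) ≤ b := by push_cast at hK; omega
      exact_mod_cast this
    nlinarith [mul_pos (lt_of_lt_of_le one_pos hdR) hα]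

/-- Integer-valued version of `circf`. -/
noncomputable def cz (x : ℝ) : ℤ := if Int.fract x ≤ 1/2 then 1 else -1

/-- Integer-valued version of `birk`. -/
noncomputable def TT (θ : ℝ) (n : ℕ) (x : ℝ) : ℤ := ∑ i ∈ Finset.range n, cz (x + i * θ)

lemma birk_eq (θ : ℝ) (n : ℕ) (x : ℝ) : birk θ n x = (TT θ n x : ℝ) := by
  unfold birk TT
  push_cast
  refine Finset.sum_congr rfl fun i _ => ?_
  unfold circf cz
  split_ifs <;> simp

lemma mem_sheavy (θ x : ℝ) :
    x ∈ sheavy θ ↔ x ∈ Set.Ico (0:ℝ) 1 ∧ ∀ n : ℕ, 1 ≤ n → 1 ≤ TT θ n x := by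
  unfold sheavy
  simp only [Set.mem_ofPred_eq, birk_eq]
  refine and_congr_right fun _ => forall₂_congr fun n _ => ?_
  rw [Int.cast_pos]
  exact Iff.rfl

lemma cz_add_int (x : ℝ) (l : ℤ) : cz (x + l) = cz x := by simp [cz]

lemma TT_add_int (θ : ℝ) (n : ℕ) (x : ℝ) (l : ℤ) : TT θ n (x + l) = TT θ n x := by
  unfold TT
  refine Finset.sum_congr rfl fun i _ => ?_
  rw [← cz_add_int (x + i * θ) l]; congr 1; ring

lemma TT_add (θ : ℝ) (m n : ℕ) (x : ℝ) :
    TT θ (m + n) x = TT θ m x + TT θ n (x + m * θ) := by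
  unfold TT
  rw [Finset.sum_range_add]
  congr 1
  refine Finset.sum_congr rfl fun i _ => ?_
  congr 1; push_cast; ring

lemma cz_cases (x : ℝ) : cz x = 1 ∨ cz x = -1 := by unfold cz; split_ifs <;> simp

lemma TT_parity (θ : ℝ) (n : ℕ) (x : ℝ) : Even (TT θ n x - n) := by
  induction n with
  | zero => simp [TT]
  | succ n ih =>
    rw [TT, Finset.sum_range_succ, ← TT]
    obtain ⟨r, hr⟩ := ih
    rcases cz_cases (x + n * θ) with h | h <;> rw [h] <;> push_cast
    · exact ⟨r, by linarith⟩
    · exact ⟨r - 1, by linarith⟩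

lemma TT_le (θ : ℝ) (n : ℕ) (x : ℝ) : TT θ n x ≤ n := by
  induction n with
  | zero => simp [TT]
  | succ n ih =>
    rw [TT, Finset.sum_range_succ, ← TT]
    push_cast
    rcases cz_cases (x + n * θ) with h | h <;> rw [h] <;> omega

lemma cz_one_iff (x : ℝ) : cz x = 1 ↔ ∃ l : ℤ, (l:ℝ) ≤ x ∧ x ≤ l + 1/2 := by
  unfold cz
  constructor
  · intro h
    split_ifs at h with h'
    · refine ⟨⌊x⌋, Int.floor_le x, ?_⟩
      have := Int.floor_add_fract x
      linarith
  · rintro ⟨l, h1, h2⟩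
    have : ⌊x⌋ = l := Int.floor_eq_iff.2 ⟨h1, by linarith⟩
    have h3 := Int.floor_add_fract x
    rw [this] at h3
    rw [if_pos (by linarith)]

lemma cz_neg_iff (x : ℝ) : cz x = -1 ↔ ∃ l : ℤ, (l:ℝ) + 1/2 < x ∧ x < l + 1 := by
  constructor
  · intro h
    refine ⟨⌊x⌋, ?_, Int.lt_floor_add_one x⟩
    by_contra! hc
    have := (cz_one_iff x).2 ⟨⌊x⌋, Int.floor_le x, hc⟩
    omega
  · rintro ⟨l, h1, h2⟩
    rcases cz_cases x with h | h
    · obtain ⟨m, h3, h4⟩ := (cz_one_iff x).1 h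
      exfalso
      have a1 : (m:ℝ) < l + 1 := by linarith
      have a2 : (l:ℝ) < m := by linarith
      norm_cast at a1 a2
      omega
    · exact h

lemma cz_half (x : ℝ) : 0 ≤ cz x + cz (x + 1/2) := by
  rcases cz_cases x with h | h
  · rcases cz_cases (x + 1/2) with h' | h' <;> omega
  · obtain ⟨l, h1, h2⟩ := (cz_neg_iff x).1 h
    have := (cz_one_iff (x + 1/2)).2 ⟨l + 1, by push_cast; linarith, by push_cast; linarith⟩
    omega

lemma TT_half (θ : ℝ) (n : ℕ) (x : ℝ) : 0 ≤ TT θ n x + TT θ n (x + 1/2) := by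
  unfold TT
  rw [← Finset.sum_add_distrib]
  refine Finset.sum_nonneg fun i _ => ?_
  have := cz_half (x + i * θ)
  rwa [show x + i * θ + 1/2 = x + 1/2 + i * θ by ring] at this

lemma cz_usc (x : ℝ) : ∀ᶠ y in nhds x, cz y ≤ cz x := by
  rcases cz_cases x with h | h
  · refine Filter.Eventually.of_forall fun y => ?_
    rcases cz_cases y with h' | h' <;> omega
  · obtain ⟨l, h1, h2⟩ := (cz_neg_iff x).1 h
    filter_upwards [Ioo_mem_nhds h1 h2] with y hy
    rw [h, (cz_neg_iff y).2 ⟨l, hy.1, hy.2⟩]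

lemma TT_usc (θ : ℝ) (n : ℕ) (x : ℝ) : ∀ᶠ y in nhds x, TT θ n y ≤ TT θ n x := by
  have : ∀ i ∈ Finset.range n, ∀ᶠ y in nhds x, cz (y + i * θ) ≤ cz (x + i * θ) := by
    intro i _
    have hc : Filter.Tendsto (fun y : ℝ => y + i * θ) (nhds x) (nhds (x + i * θ)) :=
      (continuous_id.add continuous_const).tendsto x
    exact hc.eventually (cz_usc _)
  rw [← Filter.eventually_all_finset] at this
  filter_upwards [this] with y hy
  exact Finset.sum_le_sum hy

lemma exists_sheavy {θ : ℝ} (hθ : Irrational θ) : ∃ x, x ∈ sheavy θ := by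
  by_contra! hno
  have hP : ∀ x : ℝ, ∃ n : ℕ, 1 ≤ n ∧ TT θ n x ≤ 0 := by
    intro x
    have h := hno (Int.fract x)
    rw [mem_sheavy] at h
    push Not at h
    obtain ⟨n, h1, h2⟩ := h ⟨Int.fract_nonneg x, Int.fract_lt_one x⟩
    refine ⟨n, h1, ?_⟩
    rw [← TT_add_int θ n _ ⌊x⌋, Int.fract_add_floor] at h2
    omega
  -- uniform bound
  obtain ⟨N, hN⟩ : ∃ N : ℕ, ∀ x : ℝ, ∃ n : ℕ, 1 ≤ n ∧ n ≤ N ∧ TT θ n x ≤ 0 := by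
    choose n hn1 hn2 using hP
    obtain ⟨t, -, ht⟩ := (isCompact_Icc (a := (0:ℝ)) (b := 1)).elim_nhds_subcover
      (fun x => {y | TT θ (n x) y ≤ TT θ (n x) x}) (fun x _ => TT_usc θ (n x) x)
    refine ⟨t.sup n, fun x => ?_⟩
    have hx : Int.fract x ∈ Set.Icc (0:ℝ) 1 := ⟨Int.fract_nonneg x, (Int.fract_lt_one x).le⟩
    have := ht hx
    simp only [Set.mem_iUnion, Set.mem_ofPred_eq] at this
    obtain ⟨z, hz, hz2⟩ := this
    rw [← TT_add_int θ _ _ ⌊x⌋, Int.fract_add_floor] at hz2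
    exact ⟨n z, hn1 z, Finset.le_sup hz, hz2.trans (hn2 z)⟩
  have hup : ∀ m : ℕ, ∀ x : ℝ, TT θ m x ≤ N := by
    intro m
    induction m using Nat.strong_induction_on with
    | _ m ih =>
      intro x
      by_cases hm : m ≤ N
      · exact (TT_le θ m x).trans (by exact_mod_cast hm)
      · obtain ⟨n, h1, h2, h3⟩ := hN x
        have h4 := ih (m - n) (by omega) (x + n * θ)
        have h5 := TT_add θ n (m - n) x
        rw [show n + (m - n) = m by omega] at h5
        omega
  have hlow : ∀ m : ℕ, ∀ x : ℝ, -(N:ℤ) ≤ TT θ m x := by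
    intro m x
    have := TT_half θ m x
    have := hup m (x + 1/2)
    omega
  obtain ⟨M, ⟨m0, x0, hM⟩, hmin⟩ := Int.exists_least_of_bdd
    (P := fun z => ∃ m : ℕ, ∃ x : ℝ, TT θ m x = z)
    ⟨-(N:ℤ), by rintro z ⟨m, x, rfl⟩; exact hlow m x⟩ ⟨_, 0, 0, rfl⟩
  have hmin' : ∀ m x, M ≤ TT θ m x := fun m x => hmin _ ⟨m, x, rfl⟩
  obtain ⟨ε, he, hε⟩ := Metric.eventually_nhds_iff.1 (TT_usc θ m0 x0)
  have h2θ : Irrational (2 * θ) := by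
    exact_mod_cast hθ.natCast_mul (m := 2) (by norm_num)
  obtain ⟨j, l, hj1, hj2⟩ := dense_nat h2θ (a := -θ - ε) (b := -θ + ε) (by linarith)
  set k := 2 * j + 1 with hk
  have hU : TT θ m0 (x0 + k * θ) ≤ M := by
    have := @hε (x0 + k * θ + l) (by
      rw [Real.dist_eq, abs_lt]; rw [hk]; push_cast; constructor <;> linarith)
    rwa [TT_add_int, hM] at this
  have hbig : ∀ L : ℕ, ∃ n, L ≤ n ∧ TT θ n x0 = M := by
    intro L
    induction L with
    | zero => exact ⟨m0, Nat.zero_le _, hM⟩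
    | succ L ih =>
      obtain ⟨n, h1, h2⟩ := ih
      obtain ⟨n', h3, h4⟩ := hP (x0 + n * θ)
      refine ⟨n + n', by omega, le_antisymm ?_ (hmin' _ _)⟩
      rw [TT_add]; omega
  obtain ⟨n, hn1, hn2⟩ := hbig k
  have a1 := TT_add θ k (n - k) x0
  rw [show k + (n - k) = n by omega] at a1
  have a2 := TT_add θ k m0 x0
  have a3 := hmin' (n - k) (x0 + k * θ)
  have a4 := hmin' (k + m0) x0
  obtain ⟨r, hr⟩ := TT_parity θ k x0
  have : TT θ k x0 = 0 := by omega
  omega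

/-- The cyclic model word. -/
def gg (q m : ℤ) : ℤ := if 2 * (m % q) ≤ q then 1 else -1

lemma gg_congr {q m n : ℤ} (h : m ≡ n [ZMOD q]) : gg q m = gg q n := by
  unfold gg; rw [h]

lemma gg_sum {q : ℕ} {p : ℤ} (hq : Odd q) (hc : IsCoprime p q) (D : ℤ) :
    ∑ i ∈ Finset.range q, gg q (D + i * p) = 1 := by
  obtain ⟨m, hm⟩ := hq
  have hq0 : (0:ℤ) < q := by omega
  have hinj : Set.InjOn (fun i : ℕ => ((D + i * p) % q).toNat) (Finset.range q : Set ℕ) := by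
    intro i hi j hj hij
    simp only [Finset.coe_range, Set.mem_Iio] at hi hj
    have e1 := Int.emod_nonneg (D + i * p) hq0.ne'
    have e2 := Int.emod_nonneg (D + j * p) hq0.ne'
    have e3 : (D + i * p) % q = (D + j * p) % q := by
      simp only at hij; omega
    have e4 : (q:ℤ) ∣ ((j:ℤ) - i) * p := by
      have := Int.ModEq.dvd (show D + i * p ≡ D + j * p [ZMOD q] from e3)
      convert this using 1; ring
    have e5 := hc.symm.dvd_of_dvd_mul_right e4
    have e6 : (j:ℤ) - i = 0 := by
      apply Int.eq_zero_of_abs_lt_dvd e5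
      rw [abs_lt]; constructor <;> omega
    omega
  have hmaps : Set.MapsTo (fun i : ℕ => ((D + i * p) % q).toNat)
      (Finset.range q : Set ℕ) (Finset.range q : Set ℕ) := by
    intro i _
    simp only [Finset.coe_range, Set.mem_Iio]
    have e1 := Int.emod_nonneg (D + i * p) hq0.ne'
    have e2 := Int.emod_lt_of_pos (D + i * p) hq0
    omega
  have hsurj := Finset.surjOn_of_injOn_of_card_le _ hmaps hinj le_rfl
  have : ∑ i ∈ Finset.range q, gg q (D + i * p)
      = ∑ j ∈ Finset.range q, (if j ≤ m then (1:ℤ) else -1) := by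
    refine Finset.sum_nbij _ hmaps hinj hsurj fun i _ => ?_
    unfold gg
    have e1 := Int.emod_nonneg (D + i * p) hq0.ne'
    congr 1
    apply propext
    omega
  rw [this, hm, show 2 * m + 1 = (m + 1) + m by ring, Finset.sum_range_add,
    Finset.sum_congr rfl (g := fun _ => (1:ℤ)), Finset.sum_congr (s₁ := Finset.range m) rfl
      (g := fun _ => (-1:ℤ))]
  · simp
  · intro i _; rw [if_neg (by omega)]
  · intro i hi; rw [Finset.mem_range] at hi; rw [if_pos (by omega)]

lemma shadow {θ : ℝ} {q : ℕ} {p : ℤ} (hq : Odd q) (hc : IsCoprime p q)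
    (hg : 2 * (q:ℝ) * |q * θ - p| < 1) {x : ℝ} (hx : 1 ≤ TT θ q x) :
    ∃ D : ℤ, ∀ i < q, cz (x + i * θ) = gg q (D + i * p) := by
  have hq0 : 0 < q := hq.pos
  have hqR : (0:ℝ) < q := by exact_mod_cast hq0
  have hv : ∃ C : ℤ, ∀ i < q, (C:ℝ) - 1 < 2 * q * x + 2 * i * (q * θ - p) ∧
      2 * q * x + 2 * i * (q * θ - p) < C + 1 := by
    rcases le_total 0 (q * θ - p) with h | h
    · rw [abs_of_nonneg h] at hg
      refine ⟨⌈2 * q * x⌉, fun i hi => ?_⟩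
      have h1 := Int.le_ceil (2 * q * x)
      have h2 := Int.ceil_lt_add_one (2 * q * x)
      have hi' : (i:ℝ) ≤ q := by exact_mod_cast hi.le
      have h3 : 0 ≤ 2 * (i:ℝ) * (q * θ - p) := by positivity
      have h4 : 2 * (i:ℝ) * (q * θ - p) ≤ 2 * q * (q * θ - p) := by gcongr
      constructor <;> linarith
    · rw [abs_of_nonpos h] at hg
      refine ⟨⌊2 * q * x⌋, fun i hi => ?_⟩
      have h1 := Int.floor_le (2 * q * x)
      have h2 := Int.lt_floor_add_one (2 * q * x)
      have hi' : (i:ℝ) ≤ q := by exact_mod_cast hi.le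
      have h0 : 0 ≤ -(q * θ - p) := by linarith
      have h3 : 0 ≤ 2 * (i:ℝ) * -(q * θ - p) := by positivity
      have h4 : 2 * (i:ℝ) * -(q * θ - p) ≤ 2 * q * -(q * θ - p) := by gcongr
      constructor <;> linarith
  obtain ⟨C, hC⟩ := hv
  have hle : ∀ i ∈ Finset.range q, cz (x + i * θ) ≤ gg q (C / 2 + i * p) := by
    intro i hi
    rw [Finset.mem_range] at hi
    obtain ⟨c1, c2⟩ := hC i hi
    rcases cz_cases (x + i * θ) with h | h
    · obtain ⟨l, l1, l2⟩ := (cz_one_iff _).1 h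
      have k1 : 2 * q * (l:ℝ) ≤ 2 * q * (x + i * θ) := by gcongr
      have k2 : 2 * q * (x + i * θ) ≤ 2 * q * (l + 1/2 : ℝ) := by gcongr
      have z1 : ((2 * q * l : ℤ) : ℝ) < ((C + 1 + 2 * (i * p) : ℤ) : ℝ) := by
        push_cast; linarith
      have z2 : ((C - 1 + 2 * (i * p) : ℤ) : ℝ) < ((2 * q * l + q : ℤ) : ℝ) := by
        push_cast; linarith
      rw [Int.cast_lt] at z1 z2
      have hmod : gg q (C / 2 + i * p) = gg q (C / 2 + i * p - q * l) := by
        apply gg_congr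
        exact (Int.modEq_iff_dvd.2 ⟨-l, by ring⟩)
      rw [h, hmod]
      rw [mul_assoc] at z1 z2
      generalize (q:ℤ) * l = w at *
      generalize (i:ℤ) * p = u at *
      unfold gg
      rw [Int.emod_eq_of_lt (by omega) (by omega), if_pos (by omega)]
    · rw [h]; unfold gg; split_ifs <;> norm_num
  have hs := gg_sum hq hc (C / 2)
  have hsle := Finset.sum_le_sum hle
  refine ⟨C / 2, fun i hi => ?_⟩
  have heq : ∑ i ∈ Finset.range q, cz (x + i * θ) = ∑ i ∈ Finset.range q, gg q (C / 2 + i * p) :=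
    le_antisymm hsle (by rw [hs]; exact hx)
  exact (Finset.sum_eq_sum_iff_of_le hle).1 heq i (Finset.mem_range.2 hi)

lemma same_word {θ : ℝ} {q : ℕ} {p : ℤ} (hq : Odd q) (hc : IsCoprime p q)
    (hg : 2 * (q:ℝ) * |q * θ - p| < 1) {x y : ℝ} (hx : ∀ n : ℕ, 1 ≤ n → 1 ≤ TT θ n x)
    (hy : ∀ n : ℕ, 1 ≤ n → 1 ≤ TT θ n y) :
    ∀ i < q, cz (x + i * θ) = cz (y + i * θ) := by
  have hq0 : 0 < q := hq.pos
  have hqz : (0:ℤ) < q := by exact_mod_cast hq0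
  obtain ⟨D, hD⟩ := shadow hq hc hg (hx q hq0)
  obtain ⟨E, hE⟩ := shadow hq hc hg (hy q hq0)
  obtain ⟨a, b, hab⟩ := hc
  obtain ⟨k, hk, hkE⟩ : ∃ k : ℕ, k < q ∧ E ≡ D + k * p [ZMOD q] := by
    have e1 := Int.emod_nonneg ((E - D) * a) hqz.ne'
    have e2 := Int.emod_lt_of_pos ((E - D) * a) hqz
    refine ⟨(((E - D) * a) % q).toNat, by omega, ?_⟩
    rw [Int.toNat_of_nonneg e1]
    have e3 := Int.mul_ediv_add_emod ((E - D) * a) q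
    refine Int.modEq_iff_dvd.2 ⟨-(b * (E - D)) - ((E - D) * a / q) * p, ?_⟩
    linear_combination p * e3 + (E - D) * hab
  rcases Nat.eq_zero_or_pos k with h0 | hpos
  · subst h0
    intro i hi
    rw [hD i hi, hE i hi]
    apply gg_congr
    simpa using (hkE.symm.add_right (i * p))
  · exfalso
    have h1 := TT_add θ k (q - k) x
    rw [show k + (q - k) = q by omega] at h1
    have h2 : TT θ q x = 1 := by
      rw [← gg_sum hq ⟨a, b, hab⟩ D]
      exact Finset.sum_congr rfl fun i hi => hD i (Finset.mem_range.1 hi)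
    have h3 : TT θ (q - k) (x + k * θ) = TT θ (q - k) y := by
      refine Finset.sum_congr rfl fun i hi => ?_
      rw [Finset.mem_range] at hi
      rw [hE i (by omega), show x + k * θ + i * θ = x + ((k + i : ℕ) : ℝ) * θ by push_cast; ring,
        hD (k + i) (by omega)]
      apply gg_congr
      have := hkE.symm.add_right (i * p)
      convert this using 1
      push_cast; ring
    have h4 := hx k hpos
    have h5 := hy (q - k) (by omega)
    omega

lemma separate {θ : ℝ} (hθ : Irrational θ) {x d : ℝ} (hd : 0 < d) (hd2 : d ≤ 1/2) :
    ∃ i : ℕ, cz (x + i * θ) ≠ cz (x + d + i * θ) := by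
  obtain ⟨i, l, h1, h2⟩ := dense_nat hθ (a := 1/2 - d - x) (b := 1/2 - x) (by linarith)
  refine ⟨i, ?_⟩
  rw [(cz_one_iff (x + i * θ)).2 ⟨-l, by push_cast; linarith, by push_cast; linarith⟩,
    (cz_neg_iff (x + d + i * θ)).2 ⟨-l, by push_cast; linarith, by push_cast; linarith⟩]
  norm_num

lemma unique_aux {θ : ℝ} (hθ : Irrational θ) (h0 : 0 < θ) (h1 : θ < 1) {x y : ℝ}
    (hx : x ∈ sheavy θ) (hy : y ∈ sheavy θ) (hxy : x < y) : False := by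
  rw [mem_sheavy] at hx hy
  have hall : ∀ i : ℕ, cz (x + i * θ) = cz (y + i * θ) := by
    intro i
    obtain ⟨q, p, hqi, hq, hc, hg⟩ := good_q hθ h0 h1 i
    lift q to ℕ using by omega
    refine same_word (by exact_mod_cast hq) hc (by exact_mod_cast hg) hx.2 hy.2 i
      (by exact_mod_cast hqi)
  rcases le_total (y - x) (1/2) with h | h
  · obtain ⟨i, hi⟩ := separate hθ (x := x) (d := y - x) (by linarith) h
    apply hi
    rw [hall i]; congr 1; ring
  · obtain ⟨i, hi⟩ := separate hθ (x := y) (d := 1 - (y - x))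
      (by linarith [hx.1.1, hy.1.2]) (by linarith)
    apply hi
    rw [← hall i, ← cz_add_int (x + i * θ) 1]; congr 1; push_cast; ring

/-- For every irrational `θ ∈ (0,1)`, the strictly heavy set `H*_θ` is a singleton. -/
theorem stmt11 (θ : ℝ) (hθ : Irrational θ) (h0 : 0 < θ) (h1 : θ < 1) :
    ∃! x : ℝ, x ∈ sheavy θ := by
  obtain ⟨x, hx⟩ := exists_sheavy hθ
  refine ⟨x, hx, fun y hy => ?_⟩
  rcases lt_trichotomy x y with h | h | h
  · exact (unique_aux hθ h0 h1 hx hy h).elim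
  · exact h.symm
  · exact (unique_aux hθ h0 h1 hy hx h).elim
end

section
/- Let F = ∩ᵢ Eᵢ be a nested Cantor construction in [0,1] where each interval of Eᵢ contains exactly m_{i+1} ≥ 1 closed intervals of E_{i+1}, each of relative length exactly δᵢ ≤ 1, with gaps between intervals of Eᵢ at least as large as the intervals themselves, interval lengths tending to 0, and with the sequence (m_k) not exceptionally irregular (for every ε > 0, eventually m_k < (Π_{i<k} mᵢ)^ε). Then the Hausdorff dimension of F equals liminf_{k→∞} (Σ_{i=1}^k log mᵢ)/(-Σ_{i=1}^k log δᵢ). -/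
open Filter Set

open MeasureTheory in
lemma cantor_exists_measure (m : ℕ → ℕ) (L : ℕ → ℝ)
    (c : (i : ℕ) → ((k : Fin i) → Fin (m (k.1 + 1))) → ℝ)
    (hm : ∀ i, 1 ≤ m i)
    (hLpos : ∀ i, 0 < L i)
    (hLtend : Tendsto L atTop (nhds 0))
    (hnest : ∀ (i : ℕ) (σ : (k : Fin i) → Fin (m (k.1 + 1))) (j : Fin (m (i + 1))),
      Set.Icc (c (i + 1) (Fin.snoc σ j)) (c (i + 1) (Fin.snoc σ j) + L (i + 1)) ⊆
        Set.Icc (c i σ) (c i σ + L i))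
    (hgap : ∀ (i : ℕ) (σ τ : (k : Fin i) → Fin (m (k.1 + 1))), σ ≠ τ →
      2 * L i ≤ |c i σ - c i τ|)
    (F : Set ℝ) (hF : F = ⋂ i, ⋃ σ : (k : Fin i) → Fin (m (k.1 + 1)),
      Set.Icc (c i σ) (c i σ + L i)) :
    ∃ μ : Measure ℝ, IsProbabilityMeasure μ ∧ MeasurableSet F ∧ μ Fᶜ = 0 ∧
      ∀ i σ, μ (Icc (c i σ) (c i σ + L i)) ≤
        ∏ k ∈ Finset.range i, (m (k + 1) : ENNReal)⁻¹ := by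
  have hne : ∀ k, Nonempty (Fin (m (k + 1))) := fun k => ⟨⟨0, hm _⟩⟩
  let ν : Measure ((k : ℕ) → Fin (m (k + 1))) :=
    Measure.infinitePi fun k => (PMF.uniformOfFintype (Fin (m (k + 1)))).toMeasure
  let res : ((k : ℕ) → Fin (m (k + 1))) → (i : ℕ) → (k : Fin i) → Fin (m (k.1 + 1)) :=
    fun ω i k => ω k.1
  have hsn : ∀ ω i, (Fin.snoc (α := fun k : Fin (i + 1) => Fin (m (k.1 + 1)))
      (res ω i) (ω i)) = res ω (i + 1) := by
    intro ω i
    funext k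
    refine Fin.lastCases ?_ (fun k => ?_) k
    · simp [res]
    · simp [res]
  have hstep : ∀ ω i, c i (res ω i) ≤ c (i + 1) (res ω (i + 1)) ∧
      c (i + 1) (res ω (i + 1)) + L (i + 1) ≤ c i (res ω i) + L i := by
    intro ω i
    have h := hnest i (res ω i) (ω i)
    rw [hsn] at h
    exact (Icc_subset_Icc_iff (by linarith [hLpos (i + 1)])).1 h
  have hmono : ∀ ω, Monotone fun i => c i (res ω i) :=
    fun ω => monotone_nat_of_le_succ fun i => (hstep ω i).1
  have hanti : ∀ ω, Antitone fun i => c i (res ω i) + L i :=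
    fun ω => antitone_nat_of_succ_le fun i => (hstep ω i).2
  have hle : ∀ ω i j, c j (res ω j) ≤ c i (res ω i) + L i := by
    intro ω i j
    have h1 := hmono ω (le_max_right i j)
    have h2 := hanti ω (le_max_left i j)
    have h3 := hLpos (max i j)
    simp only at h1 h2
    linarith
  let Φ : ((k : ℕ) → Fin (m (k + 1))) → ℝ := fun ω => ⨆ i, c i (res ω i)
  have hΦ : ∀ ω i, Φ ω ∈ Icc (c i (res ω i)) (c i (res ω i) + L i) := fun ω i =>
    ⟨le_ciSup (f := fun i => c i (res ω i)) ⟨_, by rintro _ ⟨j, rfl⟩; exact hle ω 0 j⟩ i,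
      ciSup_le fun j => hle ω i j⟩
  have hΦm : Measurable Φ := by
    refine measurable_of_tendsto_metrizable (f := fun i ω => c i (res ω i)) ?_ ?_
    · intro i
      have h1 : Measurable fun ω => res ω i :=
        measurable_pi_lambda _ fun k => measurable_pi_apply k.1
      exact (measurable_of_finite (c i)).comp h1
    · rw [tendsto_pi_nhds]
      intro ω
      exact tendsto_atTop_ciSup (hmono ω) ⟨_, by rintro _ ⟨j, rfl⟩; exact hle ω 0 j⟩
  have hFm : MeasurableSet F := by
    rw [hF]
    exact MeasurableSet.iInter fun i => MeasurableSet.iUnion fun σ => measurableSet_Icc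
  refine ⟨ν.map Φ, Measure.isProbabilityMeasure_map hΦm.aemeasurable, hFm, ?_, ?_⟩
  · rw [Measure.map_apply hΦm hFm.compl]
    convert measure_empty (μ := ν)
    ext ω
    simp only [mem_preimage, mem_compl_iff, mem_empty_iff_false, iff_false, not_not]
    rw [hF]
    exact mem_iInter.2 fun i => mem_iUnion.2 ⟨_, hΦ ω i⟩
  · intro i σ
    rw [Measure.map_apply hΦm measurableSet_Icc]
    have hsub : Φ ⁻¹' Icc (c i σ) (c i σ + L i) ⊆
        Set.pi (Finset.range i) (fun k => {x | ∀ h : k < i, x = σ ⟨k, h⟩}) := by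
      intro ω hω k hk h
      have : res ω i = σ := by
        by_contra hne
        have h1 := hgap i _ _ hne
        have h2 := hΦ ω i
        have h3 := hLpos i
        simp only [mem_preimage, mem_Icc] at hω h2
        have : |c i (res ω i) - c i σ| ≤ L i := abs_le.2 ⟨by linarith, by linarith⟩
        linarith
      rw [← this]
    refine (measure_mono hsub).trans ?_
    rw [Measure.infinitePi_pi _ (fun _ _ => MeasurableSet.of_discrete)]
    refine Finset.prod_le_prod' fun k hk => ?_
    have hk' := Finset.mem_range.1 hk
    have : {x : Fin (m (k + 1)) | ∀ h : k < i, x = σ ⟨k, h⟩} = {σ ⟨k, hk'⟩} := by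
      ext x; simp [hk']
    rw [this, PMF.toMeasure_apply_singleton _ _ (measurableSet_singleton _)]
    simp

lemma cantor_exp_S (m : ℕ → ℕ) (hm : ∀ i, 1 ≤ m i) (k : ℕ) :
    Real.exp (∑ i ∈ Finset.Icc 1 k, Real.log (m i)) = ∏ i ∈ Finset.range k, (m (i + 1) : ℝ) := by
  induction k with
  | zero => simp
  | succ k ih =>
    have : (0 : ℝ) < m (k + 1) := by exact_mod_cast hm (k + 1)
    rw [Finset.sum_Icc_succ_top (by omega), Real.exp_add, ih, Finset.prod_range_succ,
      Real.exp_log this]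

open MeasureTheory in
lemma cantor_lower (m : ℕ → ℕ) (L : ℕ → ℝ)
    (c : (i : ℕ) → ((k : Fin i) → Fin (m (k.1 + 1))) → ℝ)
    (hm : ∀ i, 1 ≤ m i)
    (hLpos : ∀ i, 0 < L i) (hLanti : Antitone L)
    (hLtend : Tendsto L atTop (nhds 0))
    (hnest : ∀ (i : ℕ) (σ : (k : Fin i) → Fin (m (k.1 + 1))) (j : Fin (m (i + 1))),
      Set.Icc (c (i + 1) (Fin.snoc σ j)) (c (i + 1) (Fin.snoc σ j) + L (i + 1)) ⊆
        Set.Icc (c i σ) (c i σ + L i))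
    (hgap : ∀ (i : ℕ) (σ τ : (k : Fin i) → Fin (m (k.1 + 1))), σ ≠ τ →
      2 * L i ≤ |c i σ - c i τ|)
    (F : Set ℝ) (hF : F = ⋂ i, ⋃ σ : (k : Fin i) → Fin (m (k.1 + 1)),
      Set.Icc (c i σ) (c i σ + L i))
    (s : ℝ) (hs : 0 < s)
    (h : ∀ᶠ k in atTop, s * (-Real.log (L (k + 1))) ≤ ∑ i ∈ Finset.Icc 1 k, Real.log (m i)) :
    ENNReal.ofReal s ≤ dimH F := by
  obtain ⟨μ, hμ, hFm, hμF, hμI⟩ := cantor_exists_measure m L c hm hLpos hLtend hnest hgap F hF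
  obtain ⟨K, hK⟩ := eventually_atTop.1 h
  have hI : ∀ k ≥ K, ∀ σ, μ (Icc (c k σ) (c k σ + L k)) ≤ ENNReal.ofReal (L (k + 1)) ^ s := by
    intro k hk σ
    refine (hμI k σ).trans ?_
    rw [ENNReal.ofReal_rpow_of_pos (hLpos _)]
    have h1 : ∏ i ∈ Finset.range k, (m (i + 1) : ENNReal)⁻¹ =
        ENNReal.ofReal (∏ i ∈ Finset.range k, (m (i + 1) : ℝ)⁻¹) := by
      rw [ENNReal.ofReal_prod_of_nonneg (fun i _ => by positivity)]
      refine Finset.prod_congr rfl fun i _ => ?_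
      rw [ENNReal.ofReal_inv_of_pos (by exact_mod_cast hm (i + 1)), ENNReal.ofReal_natCast]
    rw [h1]
    refine ENNReal.ofReal_le_ofReal ?_
    rw [Finset.prod_inv_distrib, ← cantor_exp_S m hm, ← Real.exp_neg,
      Real.rpow_def_of_pos (hLpos _)]
    refine Real.exp_le_exp.2 ?_
    have := hK k hk
    linarith
  have hU : ∀ U : Set ℝ, ∀ k ≥ K, Metric.ediam U < ENNReal.ofReal (L k) →
      μ U ≤ ENNReal.ofReal (L (k + 1)) ^ s := by
    intro U k hk hUk
    by_cases hne : (U ∩ F).Nonempty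
    · obtain ⟨x, hxU, hxF⟩ := hne
      have hx := hxF
      rw [hF] at hx
      obtain ⟨σ, hσ⟩ := mem_iUnion.1 (mem_iInter.1 hx k)
      have hsub : U ⊆ Fᶜ ∪ Icc (c k σ) (c k σ + L k) := by
        intro y hyU
        by_cases hyF : y ∈ F
        · right
          rw [hF] at hyF
          obtain ⟨τ, hτ⟩ := mem_iUnion.1 (mem_iInter.1 hyF k)
          have hd : |x - y| < L k := by
            have h1 := (Metric.edist_le_ediam_of_mem hxU hyU).trans_lt hUk
            rw [edist_dist, Real.dist_eq] at h1
            exact (ENNReal.ofReal_lt_ofReal_iff (hLpos k)).1 h1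
          have : σ = τ := by
            by_contra hστ
            have h1 := hgap k _ _ hστ
            have h2 := abs_lt.1 hd
            have : |c k σ - c k τ| < 2 * L k :=
              abs_lt.2 ⟨by linarith [hσ.1, hσ.2, hτ.1, hτ.2], by linarith [hσ.1, hσ.2, hτ.1, hτ.2]⟩
            linarith
          rwa [this]
        · left; exact hyF
      calc μ U ≤ μ Fᶜ + μ (Icc (c k σ) (c k σ + L k)) :=
            (measure_mono hsub).trans (measure_union_le _ _)
        _ ≤ _ := by rw [hμF, zero_add]; exact hI k hk σ
    · have : U ⊆ Fᶜ := fun y hy hyF => hne ⟨y, hy, hyF⟩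
      rw [measure_mono_null this hμF]
      exact zero_le
  have hmain : μ ≤ Measure.hausdorffMeasure s := by
    refine Measure.le_hausdorffMeasure s μ (ENNReal.ofReal (L K / 2))
      (ENNReal.ofReal_pos.2 (by linarith [hLpos K])) fun U hUd => ?_
    have hUK : Metric.ediam U < ENNReal.ofReal (L K) :=
      hUd.trans_lt ((ENNReal.ofReal_lt_ofReal_iff (hLpos K)).2 (by linarith [hLpos K]))
    have hLt : Tendsto (fun k => ENNReal.ofReal (L k)) atTop (nhds 0) := by
      simpa using ENNReal.tendsto_ofReal hLtend
    rcases eq_or_ne (Metric.ediam U) 0 with h0 | h0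
    · have h1 : Tendsto (fun k => ENNReal.ofReal (L (k + 1)) ^ s) atTop (nhds (0 ^ s)) :=
        ((ENNReal.continuous_rpow_const (y := s)).tendsto 0).comp
          (hLt.comp (tendsto_add_atTop_nat 1))
      rw [h0]
      refine ge_of_tendsto h1 (eventually_atTop.2 ⟨K, fun k hk => hU U k hk ?_⟩)
      rw [h0]; exact ENNReal.ofReal_pos.2 (hLpos k)
    · have hex : ∃ k, ENNReal.ofReal (L k) ≤ Metric.ediam U :=
        ((hLt.eventually (gt_mem_nhds (pos_iff_ne_zero.2 h0))).exists).imp fun _ h => le_of_lt h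
      classical
      have hspec := Nat.find_spec hex
      have hmin := fun n => Nat.find_min hex (m := n)
      generalize Nat.find hex = n at hspec hmin
      have hnK : K < n := by
        by_contra hcon
        have := ENNReal.ofReal_le_ofReal (hLanti (not_lt.1 hcon))
        exact absurd (this.trans hspec) (not_le.2 hUK)
      obtain ⟨k, rfl⟩ : ∃ k, n = k + 1 := ⟨n - 1, by omega⟩
      refine (hU U k (by omega) (not_le.1 (hmin k (by omega)))).trans ?_
      exact ENNReal.rpow_le_rpow hspec hs.le
  have hF1 : μ F = 1 := (prob_compl_eq_zero_iff hFm).1 hμF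
  have hpos : Measure.hausdorffMeasure (s.toNNReal : ℝ) F ≠ 0 := by
    rw [Real.coe_toNNReal _ hs.le]
    intro h0
    have := hmain F
    rw [h0, hF1] at this
    simp at this
  exact le_dimH_of_hausdorffMeasure_ne_zero hpos

open MeasureTheory in
lemma cantor_upper (m : ℕ → ℕ) (L : ℕ → ℝ)
    (c : (i : ℕ) → ((k : Fin i) → Fin (m (k.1 + 1))) → ℝ)
    (hm : ∀ i, 1 ≤ m i)
    (hLpos : ∀ i, 0 < L i)
    (hLtend : Tendsto L atTop (nhds 0))
    (F : Set ℝ) (hF : F = ⋂ i, ⋃ σ : (k : Fin i) → Fin (m (k.1 + 1)),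
      Set.Icc (c i σ) (c i σ + L i))
    (s : ℝ) (hs : 0 ≤ s)
    (h : ∃ᶠ k in atTop, ∑ i ∈ Finset.Icc 1 k, Real.log (m i) ≤ s * (-Real.log (L k))) :
    dimH F ≤ ENNReal.ofReal s := by
  have hd : ∀ k σ, Metric.ediam (Icc (c k σ) (c k σ + L k)) = ENNReal.ofReal (L k) := by
    intro k σ
    rw [Real.ediam_Icc]; congr 1; ring
  have key : Measure.hausdorffMeasure (s.toNNReal : ℝ) F ≤ 1 := by
    rw [Real.coe_toNNReal _ hs]
    refine (Measure.hausdorffMeasure_le_liminf_sum s F (l := atTop)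
      (fun k => ENNReal.ofReal (L k)) (by simpa using ENNReal.tendsto_ofReal hLtend)
      (fun k σ => Icc (c k σ) (c k σ + L k)) (Eventually.of_forall fun k σ => (hd k σ).le)
      (Eventually.of_forall fun k => ?_)).trans ?_
    · rw [hF]; exact iInter_subset _ k
    · refine liminf_le_of_frequently_le' (h.mono fun k hk => ?_)
      simp only [hd, Finset.sum_const, Finset.card_univ, Fintype.card_pi, Fintype.card_fin]
      rw [Fin.prod_univ_eq_prod_range (fun i => m (i + 1)), nsmul_eq_mul,
        ENNReal.ofReal_rpow_of_pos (hLpos _), ← ENNReal.ofReal_natCast,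
        ← ENNReal.ofReal_mul (by positivity), ← ENNReal.ofReal_one]
      refine ENNReal.ofReal_le_ofReal ?_
      push_cast
      rw [← cantor_exp_S m hm, Real.rpow_def_of_pos (hLpos _), ← Real.exp_add]
      refine Real.exp_le_one_iff.2 ?_
      linarith
  exact dimH_le_of_hausdorffMeasure_ne_top (ne_top_of_le_ne_top ENNReal.one_ne_top key)

/-- A nested Cantor construction in `[0,1]`: at level `i`, the intervals (indexed by a
choice of one of `m (k+1)` children at each earlier level `k < i`) have common length
`L i`, where `L (i+1) = δ (i+1) * L i`, each level-`i` interval contains exactly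
`m (i+1)` level-`(i+1)` intervals, intervals at each level are separated by gaps at least
as large as the intervals, lengths tend to `0`, and the sequence `m` is not exceptionally
irregular.  Then the Hausdorff dimension of the intersection `F` equals
`liminf_k (Σ_{i=1}^k log mᵢ)/(-Σ_{i=1}^k log δᵢ)`. -/
theorem stmt17 (m : ℕ → ℕ) (δ : ℕ → ℝ) (L : ℕ → ℝ)
    (c : (i : ℕ) → ((k : Fin i) → Fin (m (k.1 + 1))) → ℝ)
    (hm : ∀ i, 1 ≤ m i)
    (hδ0 : ∀ i, 0 < δ i) (hδ1 : ∀ i, δ i ≤ 1)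
    (hL0 : 0 < L 0)
    (hLrec : ∀ i, L (i + 1) = δ (i + 1) * L i)
    (hLtend : Tendsto L atTop (nhds 0))
    (hnest : ∀ (i : ℕ) (σ : (k : Fin i) → Fin (m (k.1 + 1))) (j : Fin (m (i + 1))),
      Set.Icc (c (i + 1) (Fin.snoc σ j)) (c (i + 1) (Fin.snoc σ j) + L (i + 1)) ⊆
        Set.Icc (c i σ) (c i σ + L i))
    (hgap : ∀ (i : ℕ) (σ τ : (k : Fin i) → Fin (m (k.1 + 1))), σ ≠ τ →
      2 * L i ≤ |c i σ - c i τ|)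
    (hirr : ∀ ε > (0:ℝ), ∃ N : ℕ, ∀ k ≥ N,
      (m k : ℝ) < (∏ i ∈ Finset.Ico 1 k, (m i : ℝ)) ^ ε)
    (E : ℕ → Set ℝ)
    (hE : ∀ i, E i = ⋃ σ : (k : Fin i) → Fin (m (k.1 + 1)),
      Set.Icc (c i σ) (c i σ + L i))
    (hE0 : E 0 ⊆ Set.Icc (0:ℝ) 1)
    (F : Set ℝ) (hF : F = ⋂ i, E i) :
    dimH F = ENNReal.ofReal (atTop.liminf fun k : ℕ =>
      (∑ i ∈ Finset.Icc 1 k, Real.log (m i)) /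
        (-(∑ i ∈ Finset.Icc 1 k, Real.log (δ i)))) := by
  have hLpos : ∀ i, 0 < L i := by
    intro i
    induction i with
    | zero => exact hL0
    | succ i ih => rw [hLrec]; exact mul_pos (hδ0 _) ih
  have hLanti : Antitone L := antitone_nat_of_succ_le fun i => by
    rw [hLrec]; exact mul_le_of_le_one_left (hLpos i).le (hδ1 _)
  have hF' : F = ⋂ i, ⋃ σ : (k : Fin i) → Fin (m (k.1 + 1)),
      Set.Icc (c i σ) (c i σ + L i) := by
    rw [hF]; exact iInter_congr hE
  have hL01 : L 0 ≤ 1 := by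
    rw [hE] at hE0
    have h1 : Icc (c 0 (fun k => k.elim0)) (c 0 (fun k => k.elim0) + L 0) ⊆ Icc (0 : ℝ) 1 :=
      (subset_iUnion (fun σ => Icc (c 0 σ) (c 0 σ + L 0)) (fun k => k.elim0)).trans hE0
    have h2 := (Icc_subset_Icc_iff (by linarith)).1 h1
    linarith [h2.1, h2.2]
  have hD : ∀ k, -(∑ i ∈ Finset.Icc 1 k, Real.log (δ i)) = Real.log (L 0) - Real.log (L k) := by
    intro k
    induction k with
    | zero => simp
    | succ k ih =>
      rw [Finset.sum_Icc_succ_top (by omega), hLrec,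
        Real.log_mul (hδ0 _).ne' (hLpos _).ne']
      linarith
  have hlog0 : Real.log (L 0) ≤ 0 := Real.log_nonpos hL0.le hL01
  have hlogt : Tendsto (fun k => Real.log (L 0) - Real.log (L k)) atTop atTop := by
    have h1 : Tendsto (fun k => Real.log (L k)) atTop atBot :=
      Real.tendsto_log_nhdsGT_zero.comp
        (tendsto_nhdsWithin_iff.2 ⟨hLtend, Eventually.of_forall hLpos⟩)
    simpa [sub_eq_add_neg] using
      tendsto_atTop_add_const_left _ (Real.log (L 0)) (tendsto_neg_atBot_atTop.comp h1)
  have hS0 : ∀ k, 0 ≤ ∑ i ∈ Finset.Icc 1 k, Real.log (m i) := fun k =>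
    Finset.sum_nonneg fun i _ => Real.log_natCast_nonneg _
  set g : ℕ → ℝ := fun k : ℕ => (∑ i ∈ Finset.Icc 1 k, Real.log (m i)) /
        (-(∑ i ∈ Finset.Icc 1 k, Real.log (δ i))) with hg
  have hg0 : ∀ k, 0 ≤ g k := by
    intro k
    refine div_nonneg (hS0 k) ?_
    rw [hD]
    have := Real.log_le_log (hLpos k) (hLanti (Nat.zero_le k))
    linarith
  have hlow : ∀ s s' : ℝ, 0 < s → s < s' → (∀ᶠ k in atTop, s' ≤ g k) →
      ENNReal.ofReal s ≤ dimH F := by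
    intro s s' hs hss' hev
    refine cantor_lower m L c hm hLpos hLanti hLtend hnest hgap F hF' s hs ?_
    set ε := (s' - s) / (2 * s) with hε
    have hε0 : 0 < ε := div_pos (by linarith) (by linarith)
    have hsε : s * (1 + ε) = (s + s') / 2 := by rw [hε]; field_simp; ring
    obtain ⟨N, hN⟩ := hirr ε hε0
    have hev1 := (tendsto_add_atTop_nat 1).eventually hev
    have hbig := (tendsto_add_atTop_nat 1).eventually
      (hlogt.eventually_ge_atTop (max 1 ((s + s') * (-Real.log (L 0)) / (s' - s))))
    filter_upwards [hev1, hbig, eventually_ge_atTop N] with k h1 h2 h3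
    have hD1 : 1 ≤ Real.log (L 0) - Real.log (L (k + 1)) := (le_max_left _ _).trans h2
    have hD2 := (le_max_right _ _).trans h2
    rw [div_le_iff₀ (by linarith)] at hD2
    simp only [hg] at h1
    rw [hD, le_div_iff₀ (by linarith), Finset.sum_Icc_succ_top (by omega)] at h1
    have h4 := hN (k + 1) (by omega)
    have h5 : ∏ i ∈ Finset.Ico 1 (k + 1), (m i : ℝ) =
        Real.exp (∑ i ∈ Finset.Icc 1 k, Real.log (m i)) := by
      rw [cantor_exp_S m hm, Finset.prod_Ico_eq_prod_range]
      simp [add_comm]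
    rw [h5, ← Real.exp_mul] at h4
    have hmpos : (0 : ℝ) < m (k + 1) := by exact_mod_cast hm (k + 1)
    have h6 := (Real.log_lt_log hmpos h4).le
    rw [Real.log_exp] at h6
    set S := ∑ i ∈ Finset.Icc 1 k, Real.log (m i)
    set D := Real.log (L 0) - Real.log (L (k + 1)) with hDdef
    have h7 : s' * D ≤ S * (1 + ε) := by linarith
    have h8 : s * (-Real.log (L (k + 1))) * (1 + ε) ≤ S * (1 + ε) := by
      refine le_trans ?_ h7
      have : s * (-Real.log (L (k + 1))) * (1 + ε) = (s + s') / 2 * (D - Real.log (L 0)) := by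
        rw [← hsε, hDdef]; ring
      rw [this]
      linarith
    exact le_of_mul_le_mul_right h8 (by linarith)
  have hcob : IsCoboundedUnder (· ≥ ·) atTop g := by
    refine ⟨1, fun a ha => ?_⟩
    by_contra hcon
    have ha1 : 1 < a := not_le.1 hcon
    have h1 := hlow ((1 + a) / 2) a (by linarith) (by linarith) (by simpa using ha)
    have h2 : dimH F ≤ 1 := (dimH_mono (subset_univ F)).trans Real.dimH_univ.le
    have h3 := h1.trans h2
    rw [← ENNReal.ofReal_one, ENNReal.ofReal_le_ofReal_iff (by norm_num)] at h3
    linarith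
  have hbdd : IsBoundedUnder (· ≥ ·) atTop g :=
    isBoundedUnder_of ⟨0, fun k => hg0 k⟩
  have hlim0 : 0 ≤ liminf g atTop :=
    le_liminf_of_le hcob (Eventually.of_forall hg0)
  apply le_antisymm
  · have hup : ∀ s, liminf g atTop < s → dimH F ≤ ENNReal.ofReal s := by
      intro s hs
      refine cantor_upper m L c hm hLpos hLtend F hF' s (by linarith) ?_
      have h1 := frequently_lt_of_liminf_lt hcob hs
      refine (h1.and_eventually (hlogt.eventually_ge_atTop 1)).mono ?_
      rintro k ⟨h2, h3⟩
      simp only [hg] at h2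
      rw [hD, div_lt_iff₀ (by linarith)] at h2
      have : s * Real.log (L 0) ≤ 0 := mul_nonpos_of_nonneg_of_nonpos (by linarith) hlog0
      linarith
    have ht : Tendsto ENNReal.ofReal (nhdsWithin (liminf g atTop) (Ioi (liminf g atTop)))
        (nhds (ENNReal.ofReal (liminf g atTop))) :=
      (ENNReal.continuous_ofReal.tendsto _).mono_left nhdsWithin_le_nhds
    exact ge_of_tendsto ht (eventually_nhdsWithin_of_forall fun s hs => hup s hs)
  · have ht : Tendsto ENNReal.ofReal (nhdsWithin (liminf g atTop) (Iio (liminf g atTop)))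
        (nhds (ENNReal.ofReal (liminf g atTop))) :=
      (ENNReal.continuous_ofReal.tendsto _).mono_left nhdsWithin_le_nhds
    refine le_of_tendsto ht (eventually_nhdsWithin_of_forall fun s hs => ?_)
    rcases le_or_gt s 0 with h0 | h0
    · rw [ENNReal.ofReal_of_nonpos h0]; exact zero_le
    · have hs' : s < liminf g atTop := hs
      have h1 := eventually_lt_of_lt_liminf (b := (s + liminf g atTop) / 2) (by linarith) hbdd
      exact hlow s ((s + liminf g atTop) / 2) h0 (by linarith) (h1.mono fun k hk => hk.le)
end
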